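/- With B := y · S_y A, the identity S_y(y^{−1} B) = y^{−2} A holds as formal Laurent series in y over K. -/

import Mathlib

noncomputable section

/-- The base field `K = ℂ(u)`, rational functions in the variable `u`. -/
abbrev K : Type := RatFunc ℂ

/-- The variable `u ∈ K`. -/
def u : K := RatFunc.X

/-- The formal derivative `∂_y` of a formal Laurent series in `y` over `K`. -/
def derivLS (f : LaurentSeries K) : LaurentSeries K where
  coeff := fun n => ((n + 1 : ℤ) : K) * f.coeff (n + 1)
  isPWO_support' := by
    refine ((f.isPWO_support.add (Set.isPWO_singleton (-1 : ℤ))).mono ?_)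
    intro n hn
    simp only [Function.mem_support, ne_eq] at hn
    have hf : f.coeff (n + 1) ≠ 0 := fun h => hn (by simp [h])
    rw [Set.add_singleton]
    exact ⟨n + 1, by simpa [HahnSeries.mem_support] using hf, by ring⟩

/-- Multiplication of a formal Laurent series by `y^k`. -/
def ySh (k : ℤ) (f : LaurentSeries K) : LaurentSeries K :=
  (HahnSeries.single k (1 : K)) * f

/-- The operator `S_y f = u⁻² y³ ∂_y f + (1/2) u⁻² y² f + y⁻¹ f`. -/
def Sy (f : LaurentSeries K) : LaurentSeries K :=
  (u⁻¹ ^ 2) • ySh 3 (derivLS f) + ((1 / 2 : K) * u⁻¹ ^ 2) • ySh 2 f + ySh (-1) f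

/-- `a_n = (-1)^n (6n)! / (288^n (2n)! (3n)!)`. -/
def aQ (n : ℕ) : ℚ :=
  (-1) ^ n * ((6 * n).factorial : ℚ) /
    (288 ^ n * ((2 * n).factorial : ℚ) * ((3 * n).factorial : ℚ))

/-- The power-series-in-`y` `Σ_{n ≥ 0} c_n u^{-2n} y^{3n}` (viewed as a Laurent series)
attached to rational coefficients `c : ℕ → ℚ`. -/
def mkS (c : ℕ → ℚ) : LaurentSeries K :=
  HahnSeries.ofPowerSeries ℤ K
    (PowerSeries.mk fun m => if 3 ∣ m then ((c (m / 3) : ℚ) : K) * u⁻¹ ^ (2 * (m / 3)) else 0)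

/-- The series `A = Σ_{n ≥ 0} a_n u^{-2n} y^{3n}`. -/
def A : LaurentSeries K := mkS aQ

/-- The series `B := y · S_y A`. -/
def B : LaurentSeries K := ySh 1 (Sy A)

lemma coeff_derivLS (f : LaurentSeries K) (k : ℤ) :
    (derivLS f).coeff k = ((k + 1 : ℤ) : K) * f.coeff (k + 1) := rfl

lemma coeff_ySh (k : ℤ) (f : LaurentSeries K) (m : ℤ) :
    (ySh k f).coeff m = f.coeff (m - k) := by
  simp [ySh, HahnSeries.coeff_single_mul]

lemma ySh_ySh (k l : ℤ) (f : LaurentSeries K) : ySh k (ySh l f) = ySh (k + l) f := by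
  ext m
  simp only [coeff_ySh]
  congr 1
  ring

lemma ySh_zero (f : LaurentSeries K) : ySh 0 f = f := by
  ext m
  simp [coeff_ySh]

lemma coeff_Sy (f : LaurentSeries K) (k : ℤ) :
    (Sy f).coeff k = u⁻¹ ^ 2 * ((k : K) - 3 / 2) * f.coeff (k - 2) + f.coeff (k + 1) := by
  have h : (Sy f).coeff k = u⁻¹ ^ 2 * (ySh 3 (derivLS f)).coeff k
      + (1 / 2 : K) * u⁻¹ ^ 2 * (ySh 2 f).coeff k + (ySh (-1) f).coeff k := rfl
  rw [h, coeff_ySh, coeff_ySh, coeff_ySh, coeff_derivLS, show k - 3 + 1 = k - 2 by ring,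
    sub_neg_eq_add]
  push_cast
  ring

lemma coeff_mkS_three_mul (c : ℕ → ℚ) (n : ℕ) :
    (mkS c).coeff (3 * (n : ℤ)) = (c n : K) * u⁻¹ ^ (2 * n) := by
  have h : (3 * (n : ℤ)) = ((3 * n : ℕ) : ℤ) := by push_cast; rfl
  rw [h, mkS, LaurentSeries.coeff_coe_powerSeries, PowerSeries.coeff_mk]
  simp

lemma coeff_mkS_eq_zero (c : ℕ → ℚ) (k : ℤ) (hk : ∀ n : ℕ, k ≠ 3 * n) :
    (mkS c).coeff k = 0 := by
  rw [mkS, PowerSeries.coeff_coe, PowerSeries.coeff_mk]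
  split_ifs with h h3
  · rfl
  · obtain ⟨n, hn⟩ := h3
    exact absurd (by omega) (hk n)
  · rfl

lemma aQ_succ (n : ℕ) :
    6 * ((n : ℚ) + 1) * aQ (n + 1) = -((3 * n + 5 / 2) * (3 * n + 1 / 2)) * aQ n := by
  have h2 : ((2 * n).factorial : ℚ) ≠ 0 := by positivity
  have h3 : ((3 * n).factorial : ℚ) ≠ 0 := by positivity
  simp only [aQ, show 6 * (n + 1) = 6 * n + 5 + 1 by ring, show 2 * (n + 1) = 2 * n + 1 + 1 by ring,
    show 3 * (n + 1) = 3 * n + 2 + 1 by ring, Nat.factorial_succ]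
  push_cast
  field_simp
  ring

lemma coeff_A_add_three (j : ℤ) :
    (2 * (j : K) + 6) * A.coeff (j + 3)
      = -(u⁻¹ ^ 2 * (((j : K) + 5 / 2) * ((j : K) + 1 / 2)) * A.coeff j) := by
  unfold A
  by_cases h : ∃ n : ℕ, j = 3 * n
  · obtain ⟨n, rfl⟩ := h
    have hs : 3 * (n : ℤ) + 3 = 3 * ((n + 1 : ℕ) : ℤ) := by push_cast; ring
    rw [hs, coeff_mkS_three_mul, coeff_mkS_three_mul]
    have ha := congrArg (fun q : ℚ => (q : K)) (aQ_succ n)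
    push_cast at ha ⊢
    linear_combination u⁻¹ ^ (2 * n + 2) * ha
  · push Not at h
    rw [coeff_mkS_eq_zero _ j h]
    by_cases hj : j = -3
    · subst hj
      push_cast
      ring
    · rw [coeff_mkS_eq_zero _ (j + 3) fun n hn => ?_]
      · ring
      · obtain _ | n := n
        · omega
        · exact h n (by push_cast at hn; omega)

/-- `S_y (y⁻¹ B) = y⁻² A`. -/
theorem stmt4 : Sy (ySh (-1) B) = ySh (-2) A := by
  rw [B, ySh_ySh, neg_add_cancel, ySh_zero]
  ext k
  have h := coeff_A_add_three (k - 4)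
  rw [coeff_Sy, coeff_Sy, coeff_Sy, coeff_ySh, show k - 2 - 2 = k - 4 by ring,
    show k - 2 + 1 = k - 1 by ring, show k + 1 - 2 = k - 1 by ring,
    show k + 1 + 1 = k - -2 by ring]
  rw [show k - 4 + 3 = k - 1 by ring] at h
  push_cast at h ⊢
  linear_combination u⁻¹ ^ 2 * h

end
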